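/- Let m ≥ 2 be an integer, let A_m be the dihedral Artin group on generators s, t with exponent m, and let z be its central element (z = Δ for m even, z = Δ² for m odd, where Δ is the image of prod(s,t;m)). For h ∈ A_m: if ⟨s⟩ ∩ h⟨s⟩h⁻¹ ≠ {1}, then there exists g ∈ ⟨z⟩ such that the cosets h⟨s⟩ and g⟨s⟩ coincide (equivalently, g⁻¹h ∈ ⟨s⟩); in particular h⟨s⟩h⁻¹ = ⟨s⟩. -/

import Mathlib

/-- The alternating product `a b a b ⋯` with `k` letters, starting with `a`. -/
def altProd {G : Type*} [Monoid G] (a b : G) : ℕ → G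
  | 0 => 1
  | n + 1 => a * altProd b a n

/-- The braid relation `prod(s,t;m) = prod(t,s;m)` for the dihedral Artin group,
as a single relator in the free group on two generators. -/
def braidRels (m : ℕ) : Set (FreeGroup (Fin 2)) :=
  {altProd (FreeGroup.of 0) (FreeGroup.of 1) m * (altProd (FreeGroup.of 1) (FreeGroup.of 0) m)⁻¹}

/-- The dihedral Artin group `⟨s, t | prod(s,t;m) = prod(t,s;m)⟩`. -/
abbrev DihedralArtin (m : ℕ) : Type := PresentedGroup (braidRels m)

/-- The generators of the dihedral Artin group: `s = Dgen m 0` and `t = Dgen m 1`. -/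
def Dgen (m : ℕ) (i : Fin 2) : DihedralArtin m := PresentedGroup.of i

/-- The Garside element `Δ`, the image of `prod(s,t;m)` in the dihedral Artin group. -/
def DDelta (m : ℕ) : DihedralArtin m := altProd (Dgen m 0) (Dgen m 1) m

/-- The central element `z`: equal to `Δ` for `m` even and to `Δ²` for `m` odd. -/
def Dz (m : ℕ) : DihedralArtin m := if Even m then DDelta m else (DDelta m) ^ 2

/-- The conjugate `g H g⁻¹` of a subgroup. -/
def conjSub {G : Type*} [Group G] (g : G) (H : Subgroup G) : Subgroup G :=
  H.map (MulAut.conj g).toMonoidHom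

namespace Monoid.CoprodI

variable {ι : Type*} {G : ι → Type*} [∀ i, Group (G i)]

/-- The element of the free product spelled by a list of letters. -/
def letterProd (l : List (Σ i, G i)) : CoprodI G :=
  (l.map fun x => of x.2).prod

/-- A list of letters is reduced if no letter is trivial and adjacent letters lie in different
factors. -/
def IsReduced (l : List (Σ i, G i)) : Prop :=
  (∀ x ∈ l, x.2 ≠ 1) ∧ l.IsChain fun x y => x.1 ≠ y.1

@[simp]
theorem letterProd_nil : letterProd ([] : List (Σ i, G i)) = 1 := rfl

@[simp]
theorem letterProd_cons (x : Σ i, G i) (l : List (Σ i, G i)) :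
    letterProd (x :: l) = of x.2 * letterProd l := by
  simp [letterProd]

@[simp]
theorem letterProd_append (l l' : List (Σ i, G i)) :
    letterProd (l ++ l') = letterProd l * letterProd l' := by
  simp [letterProd]

theorem isReduced_nil : IsReduced ([] : List (Σ i, G i)) := by
  simp [IsReduced]

theorem isReduced_singleton {x : Σ i, G i} (hx : x.2 ≠ 1) : IsReduced [x] := by
  simp [IsReduced, hx]

theorem isReduced_cons {x : Σ i, G i} {l : List (Σ i, G i)} :
    IsReduced (x :: l) ↔ x.2 ≠ 1 ∧ (∀ y ∈ l.head?, x.1 ≠ y.1) ∧ IsReduced l := by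
  simp only [IsReduced, List.forall_mem_cons, List.isChain_cons]
  tauto

theorem isReduced_append {l l' : List (Σ i, G i)} :
    IsReduced (l ++ l') ↔
      IsReduced l ∧ IsReduced l' ∧ ∀ x ∈ l.getLast?, ∀ y ∈ l'.head?, x.1 ≠ y.1 := by
  simp only [IsReduced, List.forall_mem_append, List.isChain_append]
  tauto

theorem exists_isReduced (g : CoprodI G) : ∃ l, IsReduced l ∧ letterProd l = g := by
  classical
  exact ⟨(Word.equiv g).toList, ⟨(Word.equiv g).ne_one, (Word.equiv g).chain_ne⟩,
    Word.equiv.symm_apply_apply g⟩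

theorem IsReduced.eq_of_letterProd_eq {l l' : List (Σ i, G i)} (h : IsReduced l)
    (h' : IsReduced l') (e : letterProd l = letterProd l') : l = l' := by
  classical
  have := Word.equiv.symm.injective (a₁ := ⟨l, h.1, h.2⟩) (a₂ := ⟨l', h'.1, h'.2⟩) e
  exact congrArg Word.toList this

theorem exists_isReduced_cons_length_le {i : ι} (a : G i) {l : List (Σ i, G i)}
    (h : IsReduced l) :
    ∃ l', IsReduced l' ∧ letterProd l' = of a * letterProd l ∧ l'.length ≤ l.length + 1 := by
  by_cases ha : a = 1
  · exact ⟨l, h, by simp [ha], by simp⟩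
  by_cases hl : ∀ y ∈ l.head?, i ≠ y.1
  · exact ⟨⟨i, a⟩ :: l, isReduced_cons.2 ⟨ha, hl, h⟩, by simp, by simp⟩
  obtain _ | ⟨⟨j, b⟩, l⟩ := l
  · simp at hl
  obtain rfl : i = j := by simpa using hl
  obtain ⟨-, hb, h⟩ := isReduced_cons.1 h
  by_cases hab : a * b = 1
  · refine ⟨l, h, ?_, by simp; lia⟩
    simp [← mul_assoc, ← map_mul, hab]
  · exact ⟨⟨i, a * b⟩ :: l, isReduced_cons.2 ⟨hab, hb, h⟩, by simp [mul_assoc], by simp⟩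

theorem exists_isReduced_length_le (l : List (Σ i, G i)) :
    ∃ l', IsReduced l' ∧ letterProd l' = letterProd l ∧ l'.length ≤ l.length := by
  induction l with
  | nil => exact ⟨[], isReduced_nil, rfl, le_rfl⟩
  | cons x l ih =>
    obtain ⟨l', h, e, hle⟩ := ih
    obtain ⟨l'', h', e', hle'⟩ := exists_isReduced_cons_length_le x.2 h
    exact ⟨l'', h', by rw [e', e, letterProd_cons], by simp; lia⟩

theorem IsReduced.length_le {l l' : List (Σ i, G i)} (h : IsReduced l)
    (e : letterProd l = letterProd l') : l.length ≤ l'.length := by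
  obtain ⟨l'', h'', e'', hle⟩ := exists_isReduced_length_le l'
  rwa [h.eq_of_letterProd_eq h'' (e.trans e''.symm)]

theorem IsReduced.eq_nil_of_commute_of {i : ι} {c : G i} (hc : c ≠ 1) {l : List (Σ i, G i)}
    (h : IsReduced l) (hlast : ∀ x ∈ l.getLast?, x.1 ≠ i)
    (hcomm : Commute (letterProd l) (of c)) : l = [] := by
  have hr : IsReduced (l ++ [⟨i, c⟩]) :=
    isReduced_append.2 ⟨h, isReduced_singleton hc, by simpa using hlast⟩
  obtain _ | ⟨⟨j, b⟩, l⟩ := l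
  · rfl
  exfalso
  by_cases hj : i = j
  · subst hj
    have := hr.length_le (l' := ⟨i, c * b⟩ :: l)
      (by simpa [mul_assoc] using hcomm.eq)
    simp at this
  · have := hr.eq_of_letterProd_eq (l' := ⟨i, c⟩ :: ⟨j, b⟩ :: l)
      (isReduced_cons.2 ⟨hc, by simpa using hj, h⟩) (by simpa [mul_assoc] using hcomm.eq)
    simp only [List.cons_append, List.cons.injEq, Sigma.mk.injEq] at this
    exact hj this.1.1.symm

/-- An element of a free product commuting with a nontrivial central element of a factor lies in
that factor. -/
theorem mem_range_of_of_commute {i : ι} {c : G i} (hc : c ≠ 1) (hcent : ∀ b : G i, Commute b c)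
    {g : CoprodI G} (hg : Commute g (of c)) : g ∈ (of : G i →* CoprodI G).range := by
  obtain ⟨l, h, rfl⟩ := exists_isReduced g
  by_cases hlast : ∀ x ∈ l.getLast?, x.1 ≠ i
  · rw [h.eq_nil_of_commute_of hc hlast hg]
    exact one_mem _
  obtain rfl | ⟨l, ⟨j, b⟩, rfl⟩ := l.eq_nil_or_concat'
  · simp at hlast
  obtain rfl : j = i := by simpa using hlast
  obtain ⟨h, -, hlast⟩ := isReduced_append.1 h
  have hb : Commute (of b : CoprodI G) (of c) := (hcent b).map of
  have hl := h.eq_nil_of_commute_of hc (by simpa using hlast) (by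
    simpa using hg.mul_left hb.inv_left)
  exact ⟨b, by simp [hl]⟩

theorem letterProd_flatten_replicate (k : ℕ) (l : List (Σ i, G i)) :
    letterProd (List.replicate k l).flatten = letterProd l ^ k := by
  induction k with
  | zero => simp
  | succ k ih => simp [List.replicate_succ, pow_succ', ih]

theorem IsReduced.flatten_replicate_append {i j : ι} (hij : i ≠ j) {a : G i} (ha : a ≠ 1)
    {y : G j} (hy : y ≠ 1) {l : List (Σ i, G i)} (h : IsReduced l)
    (hl : ∀ x ∈ l.head?, j ≠ x.1) (k : ℕ) :
    IsReduced ((List.replicate k [⟨i, a⟩, ⟨j, y⟩]).flatten ++ l) ∧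
      ∀ x ∈ ((List.replicate k [(⟨i, a⟩ : Σ i, G i), ⟨j, y⟩]).flatten ++ l).head?, j ≠ x.1 := by
  induction k with
  | zero => simpa using ⟨h, hl⟩
  | succ k ih =>
    simp only [List.replicate_succ, List.flatten_cons, List.cons_append, List.nil_append,
      isReduced_cons]
    exact ⟨⟨ha, by simpa using hij, hy, ih.2, ih.1⟩, by simpa using hij.symm⟩

theorem IsReduced.exists_eq_cons_cons {i j : ι} (hij : i ≠ j) {a : G i} (ha : a ≠ 1)
    {y : G j} (hy : y ≠ 1) {k : ℕ} (hk : k ≠ 0) {l : List (Σ i, G i)} (h : IsReduced l)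
    (hne : l ≠ []) (hlast : ∀ x ∈ l.getLast?, x.1 ≠ i)
    (hcomm : Commute (letterProd l) ((of a * of y) ^ k)) :
    ∃ l', l = ⟨i, a⟩ :: ⟨j, y⟩ :: l' := by
  obtain ⟨k, rfl⟩ := Nat.exists_eq_succ_of_ne_zero hk
  set S : ℕ → List (Σ i, G i) := fun k => (List.replicate k [⟨i, a⟩, ⟨j, y⟩]).flatten with hS
  have hSprod (k : ℕ) : letterProd (S k) = (of a * of y) ^ k := by
    simp [hS, letterProd_flatten_replicate]
  have hScons : S (k + 1) = ⟨i, a⟩ :: ⟨j, y⟩ :: S k := by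
    simp [hS, List.replicate_succ]
  have hr : IsReduced (l ++ S (k + 1)) := by
    refine isReduced_append.2 ⟨h, ?_, ?_⟩
    · simpa using (isReduced_nil.flatten_replicate_append hij ha hy (by simp) (k + 1)).1
    · simpa [hScons] using hlast
  by_cases hhead : ∀ x ∈ l.head?, j ≠ x.1
  · have e := hr.eq_of_letterProd_eq (h.flatten_replicate_append hij ha hy hhead (k + 1)).1
      (by simpa [hSprod, letterProd_flatten_replicate] using hcomm.eq)
    change l ++ S (k + 1) = S (k + 1) ++ l at e
    rw [hScons] at e
    match l, hne, e, hlast with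
    | [c], _, e, hlast =>
      simp only [List.cons_append, List.cons.injEq] at e
      simp [e.1] at hlast
    | c :: d :: l, _, e, _ =>
      simp only [List.cons_append, List.cons.injEq] at e
      exact ⟨l, by rw [e.1, e.2.1]⟩
  · exfalso
    obtain _ | ⟨⟨j', b⟩, l⟩ := l
    · exact hne rfl
    obtain rfl : j = j' := by simpa using hhead
    have := hr.length_le (l' := S k ++ ⟨i, a⟩ :: ⟨j, y * b⟩ :: l) (by
      rw [letterProd_append, hSprod, hcomm.eq, pow_succ]
      simp [hSprod, mul_assoc])
    simp [hScons] at this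
    lia

/-- If `a` and `y` are nontrivial elements of distinct factors of a free product, then every
element commuting with a positive power of `a * y` is a power of `a * y`. -/
theorem mem_zpowers_of_commute_pow {i j : ι} (hij : i ≠ j) {a : G i} (ha : a ≠ 1)
    {y : G j} (hy : y ≠ 1) {k : ℕ} (hk : k ≠ 0) {g : CoprodI G}
    (hg : Commute g ((of a * of y) ^ k)) : g ∈ Subgroup.zpowers (of a * of y : CoprodI G) := by
  obtain ⟨l, h, rfl⟩ := exists_isReduced g
  induction hn : l.length using Nat.strong_induction_on generalizing l with
  | _ n ih =>
  subst hn
  obtain rfl | hne := eq_or_ne l []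
  · exact one_mem _
  by_cases hlast : ∀ x ∈ l.getLast?, x.1 ≠ i
  · obtain ⟨l', rfl⟩ := h.exists_eq_cons_cons hij ha hy hk hne hlast hg
    have e : letterProd (⟨i, a⟩ :: ⟨j, y⟩ :: l') = of a * of y * letterProd l' := by
      simp [mul_assoc]
    have hs := Subgroup.mem_zpowers (of a * of y : CoprodI G)
    rw [e] at hg ⊢
    refine mul_mem hs
      (ih _ (by simp) l' (isReduced_cons.1 (isReduced_cons.1 h).2.2).2.2 ?_ rfl)
    rw [← inv_mul_cancel_left (of a * of y) (letterProd l')]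
    exact ((Commute.refl (of a * of y)).pow_right k).inv_left.mul_left hg
  · have hlast' : ∀ x ∈ l.getLast?, x.1 ≠ j := by
      push Not at hlast
      obtain ⟨x, hx, rfl⟩ := hlast
      intro x' hx'
      obtain rfl := Option.mem_unique hx hx'
      exact hij
    have hs : (of y⁻¹ * of a⁻¹ : CoprodI G) = (of a * of y)⁻¹ := by simp
    have hg' : Commute (letterProd l) ((of y⁻¹ * of a⁻¹) ^ k) := by
      rw [hs, inv_pow]
      exact hg.inv_right
    obtain ⟨l', rfl⟩ := h.exists_eq_cons_cons hij.symm (inv_ne_one.2 hy) (inv_ne_one.2 ha) hk hne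
      hlast' hg'
    have e : letterProd (⟨j, y⁻¹⟩ :: ⟨i, a⁻¹⟩ :: l') = (of a * of y)⁻¹ * letterProd l' := by
      simp [mul_assoc]
    rw [e] at hg ⊢
    refine mul_mem (inv_mem (Subgroup.mem_zpowers _))
      (ih _ (by simp) l' (isReduced_cons.1 (isReduced_cons.1 h).2.2).2.2 ?_ rfl)
    rw [← mul_inv_cancel_left (of a * of y) (letterProd l')]
    exact ((Commute.refl (of a * of y)).pow_right k).mul_left hg

end Monoid.CoprodI

section AltProd

variable {G H : Type*} [Group G] [Group H]

theorem map_altProd (f : G →* H) (a b : G) (k : ℕ) :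
    f (altProd a b k) = altProd (f a) (f b) k := by
  induction k generalizing a b with
  | zero => simp [altProd]
  | succ k ih => simp [altProd, ih]

theorem altProd_two_mul (a b : G) (n : ℕ) : altProd a b (2 * n) = (a * b) ^ n := by
  induction n with
  | zero => simp [altProd]
  | succ n ih => rw [Nat.mul_succ, altProd, altProd, ih, pow_succ', mul_assoc]

theorem mul_mul_pow (a b : G) (n : ℕ) : a * (b * a) ^ n = (a * b) ^ n * a := by
  have h : SemiconjBy a (b * a) (a * b) := (mul_assoc a b a).symm
  exact (h.pow_right n).eq

theorem altProd_two_mul_add_one (a b : G) (n : ℕ) :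
    altProd a b (2 * n + 1) = (a * b) ^ n * a := by
  rw [altProd, altProd_two_mul, mul_mul_pow]

end AltProd

namespace DihedralArtin

variable {m : ℕ} {H : Type*} [Group H]

theorem lift_braidRels {u v : H} (h : altProd u v m = altProd v u m) :
    ∀ r ∈ braidRels m, FreeGroup.lift ![u, v] r = 1 := by
  rintro _ rfl
  simp [map_altProd, h]

/-- The homomorphism out of `A_m` determined by a pair satisfying the braid relation. -/
def lift (u v : H) (h : altProd u v m = altProd v u m) : DihedralArtin m →* H :=
  PresentedGroup.toGroup (lift_braidRels h)

@[simp]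
theorem lift_zero (u v : H) (h : altProd u v m = altProd v u m) :
    lift u v h (Dgen m 0) = u := by
  simp [lift, Dgen]

@[simp]
theorem lift_one (u v : H) (h : altProd u v m = altProd v u m) :
    lift u v h (Dgen m 1) = v := by
  simp [lift, Dgen]

theorem hom_ext {f g : DihedralArtin m →* H} (h0 : f (Dgen m 0) = g (Dgen m 0))
    (h1 : f (Dgen m 1) = g (Dgen m 1)) : f = g := by
  refine PresentedGroup.ext fun x => ?_
  fin_cases x
  exacts [h0, h1]

theorem dDelta_eq : DDelta m = altProd (Dgen m 1) (Dgen m 0) m := by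
  have h : PresentedGroup.mk (braidRels m) (altProd (FreeGroup.of 0) (FreeGroup.of 1) m *
      (altProd (FreeGroup.of 1) (FreeGroup.of 0) m)⁻¹) = 1 :=
    PresentedGroup.one_of_mem rfl
  rw [map_mul, map_inv, mul_inv_eq_one, map_altProd, map_altProd] at h
  exact h

theorem mem_center {g : DihedralArtin m} (h0 : Commute (Dgen m 0) g)
    (h1 : Commute (Dgen m 1) g) : g ∈ Subgroup.center (DihedralArtin m) := by
  rw [Subgroup.mem_center_iff]
  intro x
  have : x ∈ Subgroup.centralizer {g} := by
    refine PresentedGroup.generated_by _ _ (fun i => ?_) x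
    rw [Subgroup.mem_centralizer_singleton_iff]
    fin_cases i
    exacts [h0.eq, h1.eq]
  exact Subgroup.mem_centralizer_singleton_iff.1 this

theorem dz_mem_center : Dz m ∈ Subgroup.center (DihedralArtin m) := by
  have hΔ := dDelta_eq (m := m)
  obtain ⟨n, rfl | rfl⟩ := m.even_or_odd'
  · have e : Dz (2 * n) = DDelta (2 * n) := by simp [Dz]
    rw [e]
    rw [altProd_two_mul] at hΔ
    have hΔ' : DDelta (2 * n) = _ := altProd_two_mul _ _ n
    refine mem_center ?_ ?_
    · rw [Commute, SemiconjBy]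
      nth_rw 1 [hΔ]
      rw [hΔ', mul_mul_pow]
    · rw [Commute, SemiconjBy]
      nth_rw 1 [hΔ']
      rw [hΔ, mul_mul_pow]
  · have e : Dz (2 * n + 1) = DDelta (2 * n + 1) * DDelta (2 * n + 1) := by simp [Dz, sq]
    rw [e]
    rw [altProd_two_mul_add_one] at hΔ
    have hΔ' : DDelta (2 * n + 1) = _ := altProd_two_mul_add_one _ _ n
    have h01 : SemiconjBy (DDelta (2 * n + 1)) (Dgen (2 * n + 1) 1) (Dgen (2 * n + 1) 0) := by
      rw [SemiconjBy]
      nth_rw 1 [hΔ']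
      rw [hΔ, ← mul_assoc, mul_mul_pow, mul_assoc]
    have h10 : SemiconjBy (DDelta (2 * n + 1)) (Dgen (2 * n + 1) 0) (Dgen (2 * n + 1) 1) := by
      rw [SemiconjBy]
      nth_rw 1 [hΔ]
      rw [hΔ', ← mul_assoc, mul_mul_pow, mul_assoc]
    exact mem_center (h01.mul_left h10).symm (h10.mul_left h01).symm

instance normal_zpowers_dz : (Subgroup.zpowers (Dz m)).Normal := by
  refine ⟨fun g hg x => ?_⟩
  have hc : g ∈ Subgroup.center (DihedralArtin m) := (Subgroup.zpowers_le.2 dz_mem_center) hg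
  rwa [Subgroup.mem_center_iff.1 hc x, mul_inv_cancel_right]

/-- The exponent homomorphism `A_m → ℤ` sending both generators to `1`. -/
def expHom (m : ℕ) : DihedralArtin m →* Multiplicative ℤ :=
  lift (.ofAdd 1) (.ofAdd 1) rfl

theorem commute_zpow_of_conj_eq {h : DihedralArtin m} {k l : ℤ}
    (e : h * Dgen m 0 ^ l * h⁻¹ = Dgen m 0 ^ k) : Commute h (Dgen m 0 ^ k) := by
  have hkl := congrArg (expHom m) e
  simp only [map_mul, map_inv, mul_inv_cancel_comm, map_zpow, expHom, lift_zero] at hkl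
  obtain rfl : l = k := by simpa [← ofAdd_zsmul] using hkl
  exact mul_inv_eq_iff_eq_mul.1 e

end DihedralArtin

/-- The free product of cyclic groups of orders `f i`, where order `0` means infinite cyclic. -/
abbrev CyclicFreeProduct {ι : Type*} (f : ι → ℕ) : Type _ :=
  Monoid.CoprodI fun i => Multiplicative (ZMod (f i))

namespace CyclicFreeProduct

open Monoid.CoprodI

variable {ι : Type*} {f : ι → ℕ} {H : Type*} [Group H]

/-- The canonical generator of the `i`-th factor. -/
def gen (f : ι → ℕ) (i : ι) : CyclicFreeProduct f :=
  of (i := i) (Multiplicative.ofAdd 1)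

/-- The homomorphism out of a free product of cyclic groups determined by the images of the
generators. -/
def lift (u : ι → H) (hu : ∀ i, u i ^ f i = 1) : CyclicFreeProduct f →* H :=
  Monoid.CoprodI.lift fun i => AddMonoidHom.toMultiplicativeLeft <|
    ZMod.lift (f i) ⟨zmultiplesHom (Additive H) (Additive.ofMul (u i)), by
      simpa [← ofMul_pow] using hu i⟩

@[simp]
theorem lift_gen (u : ι → H) (hu : ∀ i, u i ^ f i = 1) (i : ι) : lift u hu (gen f i) = u i := by
  have := ZMod.lift_coe (f i) ⟨zmultiplesHom (Additive H) (Additive.ofMul (u i)), by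
      simpa [← ofMul_pow] using hu i⟩ 1
  simp only [Int.cast_one] at this
  simp [lift, gen, this]

theorem gen_zpow (i : ι) (k : ℤ) :
    gen f i ^ k = of (i := i) (Multiplicative.ofAdd (k : ZMod (f i))) := by
  rw [gen, ← map_zpow, ← ofAdd_zsmul, zsmul_one]

theorem gen_pow_self (i : ι) : gen f i ^ f i = 1 := by
  rw [← zpow_natCast, gen_zpow]
  simp

theorem range_of (i : ι) :
    (of (i := i) : _ →* CyclicFreeProduct f).range = Subgroup.zpowers (gen f i) := by
  ext x
  constructor
  · rintro ⟨b, rfl⟩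
    obtain ⟨k, hk⟩ := ZMod.intCast_surjective b.toAdd
    exact ⟨k, by simp [gen_zpow, hk]⟩
  · rintro ⟨k, rfl⟩
    exact ⟨_, (gen_zpow i k).symm⟩

end CyclicFreeProduct

namespace DihedralArtin

open CyclicFreeProduct

variable {m : ℕ}

/-- If `A_m → P` is a homomorphism through which `A_m → A_m/⟨z⟩` factors, and centralizers in `P`
of nontrivial powers of the image of `s` are generated by that image, then the centralizer of a
nontrivial power of `s` is contained in `⟨z⟩⟨s⟩`. -/
theorem exists_mem_zpowers_of_factor {P : Type*} [Group P] (φ : DihedralArtin m →* P)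
    (ψ : P →* DihedralArtin m ⧸ Subgroup.zpowers (Dz m))
    (h0 : ψ (φ (Dgen m 0)) = QuotientGroup.mk (Dgen m 0))
    (h1 : ψ (φ (Dgen m 1)) = QuotientGroup.mk (Dgen m 1))
    {k : ℤ} (hP : ∀ g : P, Commute g (φ (Dgen m 0) ^ k) → g ∈ Subgroup.zpowers (φ (Dgen m 0)))
    {h : DihedralArtin m} (hh : Commute h (Dgen m 0 ^ k)) :
    ∃ g ∈ Subgroup.zpowers (Dz m), g⁻¹ * h ∈ Subgroup.zpowers (Dgen m 0) := by
  have hcomp : ψ.comp φ = QuotientGroup.mk' _ := hom_ext h0 h1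
  obtain ⟨j, hj⟩ := hP (φ h) (by simpa using hh.map φ)
  have hj' := congrArg ψ hj
  simp only [← map_zpow] at hj'
  replace hj' : QuotientGroup.mk' (Subgroup.zpowers (Dz m)) (Dgen m 0 ^ j) =
      QuotientGroup.mk' _ h := by
    rw [← hcomp]
    exact hj'
  have hz : (Dgen m 0 ^ j)⁻¹ * h ∈ Subgroup.zpowers (Dz m) := QuotientGroup.eq.1 hj'
  refine ⟨_, hz, j, ?_⟩
  have hc := Subgroup.mem_center_iff.1 (Subgroup.zpowers_le.2 dz_mem_center hz) (Dgen m 0 ^ j)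
  rw [eq_inv_mul_iff_mul_eq]
  change _ * Dgen m 0 ^ j = h
  rw [← hc, mul_inv_cancel_left]

theorem exists_mem_zpowers_of_commute_even {n : ℕ} {k : ℤ} (hk : k ≠ 0)
    {h : DihedralArtin (2 * n)} (hh : Commute h (Dgen (2 * n) 0 ^ k)) :
    ∃ g ∈ Subgroup.zpowers (Dz (2 * n)), g⁻¹ * h ∈ Subgroup.zpowers (Dgen (2 * n) 0) := by
  let f : Fin 2 → ℕ := ![0, n]
  have hx : gen f 1 ^ n = 1 := gen_pow_self (f := f) 1
  have hxz : (Dgen (2 * n) 0 * Dgen (2 * n) 1) ^ n = Dz (2 * n) := by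
    simp [Dz, DDelta, altProd_two_mul]
  refine exists_mem_zpowers_of_factor
    (lift (gen f 0) ((gen f 0)⁻¹ * gen f 1) ?_)
    (CyclicFreeProduct.lift (f := f) ![QuotientGroup.mk (Dgen _ 0),
      QuotientGroup.mk (Dgen _ 0 * Dgen _ 1)] ?_) ?_ ?_ (k := k) ?_ hh
  · have e : (gen f 0)⁻¹ * gen f 1 * gen f 0 = (gen f 0)⁻¹ * gen f 1 * (gen f 0)⁻¹⁻¹ := by simp
    rw [altProd_two_mul, altProd_two_mul, mul_inv_cancel_left, e, conj_pow, hx]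
    simp
  · rw [Fin.forall_fin_two]
    refine ⟨pow_zero _, ?_⟩
    change QuotientGroup.mk ((Dgen (2 * n) 0 * Dgen (2 * n) 1) ^ n) = _
    rw [hxz, QuotientGroup.eq_one_iff]
    exact Subgroup.mem_zpowers _
  · simp
  · simp
  · intro g hg
    rw [lift_zero, gen_zpow] at hg
    rw [lift_zero, ← range_of]
    refine Monoid.CoprodI.mem_range_of_of_commute ?_ (fun b => Commute.all b _) hg
    rw [ne_eq, ofAdd_eq_one, ZMod.intCast_zmod_eq_zero_iff_dvd]
    exact fun hd => hk (zero_dvd_iff.1 hd)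

theorem exists_mem_zpowers_of_commute_odd {n : ℕ} (hn : n ≠ 0) {k : ℤ} (hk : k ≠ 0)
    {h : DihedralArtin (2 * n + 1)} (hh : Commute h (Dgen (2 * n + 1) 0 ^ k)) :
    ∃ g ∈ Subgroup.zpowers (Dz (2 * n + 1)),
      g⁻¹ * h ∈ Subgroup.zpowers (Dgen (2 * n + 1) 0) := by
  let f : Fin 2 → ℕ := ![2 * n + 1, 2]
  set x := gen f 0 with hxdef
  set y := gen f 1 with hydef
  have hx : x ^ (2 * n + 1) = 1 := gen_pow_self (f := f) 0
  have hy : y * y = 1 := by rw [← sq]; exact gen_pow_self (f := f) 1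
  have hΔ : DDelta (2 * n + 1) = (Dgen (2 * n + 1) 0 * Dgen (2 * n + 1) 1) ^ n * Dgen _ 0 :=
    altProd_two_mul_add_one _ _ n
  have hΔ' := dDelta_eq (m := 2 * n + 1)
  have hz : DDelta (2 * n + 1) ^ 2 = Dz (2 * n + 1) := by simp [Dz]
  have hxz : (Dgen (2 * n + 1) 0 * Dgen (2 * n + 1) 1) ^ (2 * n + 1) = Dz (2 * n + 1) := by
    rw [← hz, sq]
    nth_rw 2 [hΔ']
    rw [hΔ, altProd, altProd_two_mul]
    rw [show 2 * n + 1 = n + 1 + n by ring, pow_add, pow_succ]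
    simp only [mul_assoc]
  have hs : x ^ (-n : ℤ) * y * ((x ^ (-n : ℤ) * y)⁻¹ * x) = x := mul_inv_cancel_left _ _
  refine exists_mem_zpowers_of_factor
    (lift (x ^ (-n : ℤ) * y) ((x ^ (-n : ℤ) * y)⁻¹ * x) ?_)
    (CyclicFreeProduct.lift (f := f) ![QuotientGroup.mk (Dgen _ 0 * Dgen _ 1),
      QuotientGroup.mk (DDelta _)] ?_) ?_ ?_ (k := k) ?_ hh
  · have hyi : y⁻¹ = y := inv_eq_of_mul_eq_one_right hy
    have e : (x ^ (-n : ℤ) * y)⁻¹ * x * (x ^ (-n : ℤ) * y) = y⁻¹ * x * y⁻¹⁻¹ := by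
      simp only [mul_inv_rev, zpow_neg, inv_inv, zpow_natCast, mul_assoc]
      rw [← mul_assoc x, (Commute.self_pow x n).inv_right.eq]
      simp [mul_assoc]
    rw [altProd_two_mul_add_one, altProd_two_mul_add_one, hs, e, conj_pow]
    simp only [mul_inv_rev, zpow_neg, inv_inv, zpow_natCast, mul_assoc, mul_inv_cancel_left]
    rw [← pow_succ, ← pow_add, show n + (n + 1) = 2 * n + 1 by ring, hx, hyi, mul_one]
  · rw [Fin.forall_fin_two]
    constructor
    · change QuotientGroup.mk ((Dgen (2 * n + 1) 0 * Dgen (2 * n + 1) 1) ^ (2 * n + 1)) = _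
      rw [hxz, QuotientGroup.eq_one_iff]
      exact Subgroup.mem_zpowers _
    · change QuotientGroup.mk (DDelta (2 * n + 1) ^ 2) = _
      rw [hz, QuotientGroup.eq_one_iff]
      exact Subgroup.mem_zpowers _
  · simp [hxdef, hydef, hΔ]
  · simp [hxdef, hydef, hΔ]
  · intro g hg
    rw [lift_zero] at hg ⊢
    have ha : Multiplicative.ofAdd ((-n : ℤ) : ZMod (f 0)) ≠ 1 := by
      rw [ne_eq, ofAdd_eq_one, ZMod.intCast_zmod_eq_zero_iff_dvd]
      intro hd
      have hd' : 2 * n + 1 ∣ n := by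
        rw [dvd_neg] at hd
        exact_mod_cast hd
      have := Nat.le_of_dvd (Nat.pos_of_ne_zero hn) hd'
      lia
    have hb : Multiplicative.ofAdd (1 : ZMod (f 1)) ≠ 1 := by
      change (1 : ZMod 2) ≠ 0
      decide
    have hg' : Commute g ((x ^ (-n : ℤ) * y) ^ k.natAbs) := by
      rcases Int.natAbs_eq k with e | e
      · rwa [e, zpow_natCast] at hg
      · rw [e, zpow_neg, zpow_natCast] at hg
        simpa using hg.inv_right
    rw [hxdef, gen_zpow] at hg' ⊢
    exact Monoid.CoprodI.mem_zpowers_of_commute_pow (by decide) ha hb (Int.natAbs_ne_zero.2 hk) hg'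

end DihedralArtin

theorem conjSub_zpowers {G : Type*} [Group G] (h a : G) :
    conjSub h (Subgroup.zpowers a) = Subgroup.zpowers (h * a * h⁻¹) := by
  simp [conjSub, MonoidHom.map_zpowers]

/-- In the dihedral Artin group `A_m` with `m ≥ 2`: if `⟨s⟩ ∩ h⟨s⟩h⁻¹`
is non-trivial, then there is `g ∈ ⟨z⟩` with `h⟨s⟩ = g⟨s⟩` (i.e. `g⁻¹h ∈ ⟨s⟩`); in particular
`h⟨s⟩h⁻¹ = ⟨s⟩`. -/
theorem dihedralArtin_same_type_edges (m : ℕ) (hm : 2 ≤ m) (h : DihedralArtin m)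
    (hne : Subgroup.zpowers (Dgen m 0) ⊓ conjSub h (Subgroup.zpowers (Dgen m 0)) ≠ ⊥) :
    (∃ g ∈ Subgroup.zpowers (Dz m), g⁻¹ * h ∈ Subgroup.zpowers (Dgen m 0)) ∧
    conjSub h (Subgroup.zpowers (Dgen m 0)) = Subgroup.zpowers (Dgen m 0) := by
  obtain ⟨⟨_, ⟨k, rfl⟩, hl⟩, hk1⟩ := (Subgroup.ne_bot_iff_exists_ne_one).1 hne
  rw [SetLike.mem_coe, conjSub_zpowers] at hl
  obtain ⟨l, hl⟩ := hl
  have hk : k ≠ 0 := by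
    rintro rfl
    exact hk1 (Subtype.ext (zpow_zero _))
  have hcomm : Commute h (Dgen m 0 ^ k) :=
    DihedralArtin.commute_zpow_of_conj_eq (l := l) (by simpa [conj_zpow] using hl)
  have hex : ∃ g ∈ Subgroup.zpowers (Dz m), g⁻¹ * h ∈ Subgroup.zpowers (Dgen m 0) := by
    obtain ⟨n, rfl | rfl⟩ := m.even_or_odd'
    · exact DihedralArtin.exists_mem_zpowers_of_commute_even hk hcomm
    · exact DihedralArtin.exists_mem_zpowers_of_commute_odd (by lia) hk hcomm
  refine ⟨hex, ?_⟩
  obtain ⟨g, hg, j, hj⟩ := hex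
  have hgc : Commute g (Dgen m 0) :=
    (Subgroup.mem_center_iff.1 (Subgroup.zpowers_le.2 DihedralArtin.dz_mem_center hg) _).symm
  have hh : Commute h (Dgen m 0) := by
    rw [← mul_inv_cancel_left g h, ← hj]
    exact hgc.mul_left ((Commute.refl _).zpow_left j)
  rw [conjSub_zpowers, hh.eq, mul_inv_cancel_right]
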